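/- arXiv:1004.5166 — 2 statements merged into one kernel-verified Lean document; each statement's English description precedes it below -/
import Mathlib

section
/- Let K be a field, V a finite-dimensional K-vector space, and B a symmetric bilinear form on V that is degenerate on V. Let k be an integer with 1 ≤ k < dim V, and let {H_1,…,H_ℓ} be a complete set of hyperplanes in V. For a nonempty subset J ⊆ {1,…,ℓ} write H_J = ⋂_{j∈J} H_j. If B is degenerate on H_J for every nonempty subset J with |J| ≤ k, then rank_V B < dim V − k. (Criterion to bound rank.) -/
/-- The radical of the bilinear form `B` restricted to the subspace `W`:
`rad W = {w ∈ W | ∀ w' ∈ W, B w w' = 0}`. -/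
noncomputable def radOn {K V : Type*} [Field K] [AddCommGroup V] [Module K V]
    (B : V →ₗ[K] V →ₗ[K] K) (W : Submodule K V) : Submodule K V :=
  W ⊓ ⨅ w' ∈ W, LinearMap.ker (B.flip w')

open Module

theorem mem_radOn_iff {K V : Type*} [Field K] [AddCommGroup V] [Module K V]
    (B : V →ₗ[K] V →ₗ[K] K) (W : Submodule K V) (v : V) :
    v ∈ radOn B W ↔ v ∈ W ∧ ∀ w ∈ W, B v w = 0 := by
  simp [radOn, Submodule.mem_iInf]

/-- A family of subspaces with trivial intersection contains a subfamily of size at most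
`dim R` whose intersection is disjoint from a given subspace `R`. -/
theorem exists_finset_card_le_disjoint_iInf {K V ι : Type*} [Field K] [AddCommGroup V]
    [Module K V] [FiniteDimensional K V] (H : ι → Submodule K V) (hH : ⨅ i, H i = ⊥)
    (R : Submodule K V) :
    ∃ J : Finset ι, J.card ≤ finrank K R ∧ Disjoint (⨅ j ∈ J, H j) R := by
  classical
  induction hn : finrank K R using Nat.strong_induction_on generalizing R with
  | _ n ih =>
    by_cases hR : R = ⊥
    · exact ⟨∅, by simp, by simp [hR]⟩
    · obtain ⟨i, hi⟩ : ∃ i, ¬ R ≤ H i := by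
        by_contra! h
        exact hR (le_bot_iff.mp (hH ▸ le_iInf h))
      have hlt : finrank K (H i ⊓ R : Submodule K V) < n :=
        hn ▸ Submodule.finrank_lt_finrank_of_lt
          (lt_of_le_of_ne inf_le_right fun h => hi (inf_eq_right.mp h))
      obtain ⟨J, hJ, hdisj⟩ := ih _ hlt _ rfl
      refine ⟨insert i J, (Finset.card_insert_le _ _).trans (by omega), ?_⟩
      rw [Finset.iInf_insert, disjoint_iff, inf_right_comm, inf_comm, ← disjoint_iff]
      exact hdisj

/-- An intersection of `m` hyperplanes has codimension at most `m`. -/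
theorem finrank_le_finrank_iInf_add_card {K V ι : Type*} [Field K] [AddCommGroup V]
    [Module K V] [FiniteDimensional K V] (H : ι → Submodule K V)
    (hH : ∀ i, finrank K (H i) + 1 = finrank K V) (J : Finset ι) :
    finrank K V ≤ finrank K (⨅ j ∈ J, H j : Submodule K V) + J.card := by
  classical
  induction J using Finset.induction_on with
  | empty =>
    have htop : ⨅ j ∈ (∅ : Finset ι), H j = ⊤ := by simp
    rw [htop, finrank_top, Finset.card_empty, add_zero]
  | insert i J hi ih =>
    rw [Finset.iInf_insert, Finset.card_insert_of_notMem hi]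
    have hsum := Submodule.finrank_sup_add_finrank_inf_eq (H i) (⨅ j ∈ J, H j)
    have hle := Submodule.finrank_le (H i ⊔ ⨅ j ∈ J, H j)
    have := hH i
    omega

/-- A symmetric bilinear form is nondegenerate on any complement of its radical. -/
theorem radOn_eq_bot_of_isCompl {K V : Type*} [Field K] [AddCommGroup V] [Module K V]
    (B : V →ₗ[K] V →ₗ[K] K) (hsym : ∀ v w, B v w = B w v) {W : Submodule K V}
    (hW : IsCompl W (radOn B ⊤)) : radOn B W = ⊥ := by
  rw [eq_bot_iff]
  intro w hw
  obtain ⟨hwW, hwB⟩ := (mem_radOn_iff B W w).mp hw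
  refine hW.disjoint.le_bot ⟨hwW, (mem_radOn_iff B ⊤ w).mpr ⟨trivial, fun v _ => ?_⟩⟩
  obtain ⟨x, hx, y, hy, rfl⟩ := Submodule.mem_sup.mp (hW.sup_eq_top ▸ Submodule.mem_top (x := v))
  rw [map_add, hwB x hx, hsym w y, ((mem_radOn_iff B ⊤ y).mp hy).2 w trivial, add_zero]

/-- Criterion to bound rank: if `B` is a degenerate symmetric bilinear form on
`V`, `1 ≤ k < dim V`, `{H_1, …, H_ℓ}` is a complete set of hyperplanes in `V`,
and `B` is degenerate on `H_J = ⋂_{j ∈ J} H_j` for every nonempty `J` with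
`|J| ≤ k`, then `rank_V B < dim V − k`. -/
theorem stmt7 {K V : Type*} [Field K] [AddCommGroup V] [Module K V]
    [FiniteDimensional K V]
    (B : V →ₗ[K] V →ₗ[K] K) (hsym : ∀ v w, B v w = B w v)
    (hdeg : radOn B ⊤ ≠ ⊥)
    (k : ℕ) (hk1 : 1 ≤ k) (hk2 : k < Module.finrank K V)
    {ℓ : ℕ} (H : Fin ℓ → Submodule K V)
    (hhyp : ∀ i, Module.finrank K (H i) + 1 = Module.finrank K V)
    (hcomp : ⨅ i, H i = ⊥)
    (hJ : ∀ J : Finset (Fin ℓ), J.Nonempty → J.card ≤ k →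
      radOn B (⨅ j ∈ J, H j) ≠ ⊥) :
    Module.finrank K V - Module.finrank K (radOn B ⊤) < Module.finrank K V - k := by
  have hlt : k < finrank K (radOn B ⊤) := by
    by_contra! hle
    obtain ⟨J, hJcard, hdisj⟩ := exists_finset_card_le_disjoint_iInf H hcomp (radOn B ⊤)
    have hcodim := finrank_le_finrank_iInf_add_card H hhyp J
    have hsup : (⨅ j ∈ J, H j) ⊔ radOn B ⊤ = ⊤ := by
      apply Submodule.eq_top_of_finrank_eq
      have hsum := Submodule.finrank_sup_add_finrank_inf_eq (⨅ j ∈ J, H j) (radOn B ⊤)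
      rw [hdisj.eq_bot, finrank_bot] at hsum
      have := Submodule.finrank_le ((⨅ j ∈ J, H j) ⊔ radOn B ⊤)
      omega
    have hne : J.Nonempty := by
      rw [Finset.nonempty_iff_ne_empty]
      rintro rfl
      exact hdeg (by simpa using hdisj)
    exact hJ J hne (hJcard.trans hle)
      (radOn_eq_bot_of_isCompl B hsym ⟨hdisj, codisjoint_iff.mpr hsup⟩)
  omega
end

section
/- Let K be a field, V a finite-dimensional K-vector space, and B a symmetric bilinear form on V that is degenerate on V. Then every complete set of hyperplanes {H_1,…,H_ℓ} in V contains a hyperplane H_i such that rank_V B = rank_{H_i} B. -/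
theorem mem_radOn {K V : Type*} [Field K] [AddCommGroup V] [Module K V]
    {B : V →ₗ[K] V →ₗ[K] K} {W : Submodule K V} {v : V} :
    v ∈ radOn B W ↔ v ∈ W ∧ ∀ w ∈ W, B v w = 0 := by
  simp [radOn, Submodule.mem_iInf]

/-- A subspace that together with the radical of `B` spans the whole space has radical equal to
its intersection with the radical of `B`. -/
theorem radOn_eq_inf_of_sup_eq_top {K V : Type*} [Field K] [AddCommGroup V] [Module K V]
    (B : V →ₗ[K] V →ₗ[K] K) (hsym : ∀ v w, B v w = B w v) {W : Submodule K V}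
    (h : radOn B ⊤ ⊔ W = ⊤) : radOn B W = radOn B ⊤ ⊓ W := by
  ext v
  simp only [Submodule.mem_inf, mem_radOn]
  refine ⟨fun ⟨hv, hW⟩ ↦ ⟨⟨trivial, fun x _ ↦ ?_⟩, hv⟩, fun ⟨⟨_, hr⟩, hv⟩ ↦
    ⟨hv, fun w _ ↦ hr w trivial⟩⟩
  obtain ⟨r, hr, w, hw, rfl⟩ := Submodule.mem_sup.mp (h.ge (Submodule.mem_top (x := x)))
  rw [map_add, hW w hw, hsym, (mem_radOn.mp hr).2 v trivial, add_zero]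

/-- If `B` is a degenerate symmetric bilinear form on `V`, then every complete
set of hyperplanes `{H_1, …, H_ℓ}` in `V` contains a hyperplane `H_i` with
`rank_V B = rank_{H_i} B`. -/
theorem stmt8 {K V : Type*} [Field K] [AddCommGroup V] [Module K V]
    [FiniteDimensional K V]
    (B : V →ₗ[K] V →ₗ[K] K) (hsym : ∀ v w, B v w = B w v)
    (hdeg : radOn B ⊤ ≠ ⊥)
    {ℓ : ℕ} (H : Fin ℓ → Submodule K V)
    (hhyp : ∀ i, Module.finrank K (H i) + 1 = Module.finrank K V)
    (hcomp : ⨅ i, H i = ⊥) :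
    ∃ i : Fin ℓ, Module.finrank K V - Module.finrank K (radOn B ⊤) =
      Module.finrank K (H i) - Module.finrank K (radOn B (H i)) := by
  obtain ⟨r, hr, hr0⟩ := Submodule.exists_mem_ne_zero_of_ne_bot hdeg
  obtain ⟨i, hi⟩ : ∃ i, r ∉ H i := by
    by_contra! hall
    exact hr0 ((Submodule.mem_bot K).mp (hcomp ▸ (Submodule.mem_iInf H).mpr hall))
  have hlt : H i < radOn B ⊤ ⊔ H i :=
    lt_of_le_of_ne le_sup_right fun heq ↦ hi (heq ▸ Submodule.mem_sup_left hr)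
  have hdim := Submodule.finrank_lt_finrank_of_lt hlt
  have hle := Submodule.finrank_le (radOn B ⊤ ⊔ H i)
  have hH := hhyp i
  have htop : radOn B ⊤ ⊔ H i = ⊤ := Submodule.eq_top_of_finrank_eq (by omega)
  have hsum := Submodule.finrank_sup_add_finrank_inf_eq (radOn B ⊤) (H i)
  refine ⟨i, ?_⟩
  rw [radOn_eq_inf_of_sup_eq_top B hsym htop]
  omega
end
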